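/- Let s ∈ 𝔛 with s_k > 0 for all k, and let ψ_s denote the inverse of the mean map of the natural exponential family F(R*_s) generated by the Riesz measure R*_s (so ψ_s : 𝒬 → 𝒫). Then for every m ∈ 𝒬: ψ_s(m) = s_r φ_r*(φ_r(m)^{−1}) + Σ_{i=1}^{r−1} s_i ( φ_i*(φ_i(m)^{−1}) − φ̌_i*(φ̌_i(m)^{−1}) ). -/

import Mathlib

open Matrix MeasureTheory Finset
open scoped ENNReal

namespace Wishart

instance {m n α : Type*} [MeasurableSpace α] : MeasurableSpace (Matrix m n α) :=
  inferInstanceAs (MeasurableSpace (m → n → α))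

/-- Index set of an `N × N` matrix partitioned into `r + 1` blocks of sizes `n 0, …, n r`. -/
abbrev Idx (r : ℕ) (n : Fin (r + 1) → ℕ+) := Σ k : Fin (r + 1), Fin (n k)

/-- Real matrices over the partitioned index set. -/
abbrev Mat (r : ℕ) (n : Fin (r + 1) → ℕ+) := Matrix (Idx r n) (Idx r n) ℝ

variable {r : ℕ} {n : Fin (r + 1) → ℕ+}

/-- The `(l,k)` block of a partitioned matrix. -/
def blk (x : Mat r n) (l k : Fin (r + 1)) : Matrix (Fin (n l)) (Fin (n k)) ℝ :=
  Matrix.of fun a b => x ⟨l, a⟩ ⟨k, b⟩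

variable (V : ∀ l k : Fin (r + 1), Submodule ℝ (Matrix (Fin (n l)) (Fin (n k)) ℝ))

/-- Condition (V1): `A ∈ 𝒱_{lk}`, `B ∈ 𝒱_{ki}` implies `A B ∈ 𝒱_{li}` for `i < k < l`. -/
def CondV1 : Prop := ∀ i k l : Fin (r + 1), i < k → k < l →
  ∀ A ∈ V l k, ∀ B ∈ V k i, A * B ∈ V l i

/-- Condition (V2): `A ∈ 𝒱_{li}`, `B ∈ 𝒱_{ki}` implies `A Bᵀ ∈ 𝒱_{lk}` for `i < k < l`. -/
def CondV2 : Prop := ∀ i k l : Fin (r + 1), i < k → k < l →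
  ∀ A ∈ V l i, ∀ B ∈ V k i, A * Bᵀ ∈ V l k

/-- Condition (V3): `A ∈ 𝒱_{lk}` implies `A Aᵀ ∈ ℝ I`. -/
def CondV3 : Prop := ∀ k l : Fin (r + 1), k < l →
  ∀ A ∈ V l k, ∃ c : ℝ, A * Aᵀ = c • (1 : Matrix (Fin (n l)) (Fin (n l)) ℝ)

/-- The space `𝒵` of symmetric matrices with lower blocks in `𝒱_{lk}` and scalar diagonal
blocks. -/
def Zspace : Set (Mat r n) :=
  {x | x.IsSymm ∧ (∀ k l : Fin (r + 1), k < l → blk x l k ∈ V l k) ∧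
    ∀ k : Fin (r + 1), ∃ c : ℝ, ∀ a b : Fin (n k),
      x ⟨k, a⟩ ⟨k, b⟩ = if a = b then c else 0}

/-- The trace inner product `⟨x, y⟩ = tr (x y)`. -/
def tip (x y : Mat r n) : ℝ := (x * y).trace

/-- The homogeneous cone `𝒫 = 𝒵 ∩ Sym₊(N, ℝ)`. -/
def Pcone : Set (Mat r n) := {x | x ∈ Zspace V ∧ x.PosDef}

/-- The dual cone `𝒬 = {ξ ∈ 𝒵 : ⟨ξ, x⟩ > 0 for all nonzero x in the closure of 𝒫}`. -/
def Qcone : Set (Mat r n) :=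
  {ξ | ξ ∈ Zspace V ∧ ∀ x ∈ closure (Pcone V), x ≠ 0 → 0 < tip ξ x}

/-- The group `H` of block lower triangular matrices with strictly lower blocks in `𝒱_{lk}`
and positive scalar diagonal blocks. -/
def Hgrp : Set (Mat r n) :=
  {T | (∀ k l : Fin (r + 1), l < k → blk T l k = 0) ∧
    (∀ k l : Fin (r + 1), k < l → blk T l k ∈ V l k) ∧
    ∀ k : Fin (r + 1), ∃ t : ℝ, 0 < t ∧ ∀ a b : Fin (n k),
      T ⟨k, a⟩ ⟨k, b⟩ = if a = b then t else 0}

/-- `ρ(T) x = T x Tᵀ`. -/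
def rhoM (T x : Mat r n) : Mat r n := T * x * Tᵀ

/-- The diagonal scalar `t_{kk}` of a matrix with scalar diagonal blocks. -/
def tdiag (T : Mat r n) (k : Fin (r + 1)) : ℝ :=
  T ⟨k, ⟨0, (n k).2⟩⟩ ⟨k, ⟨0, (n k).2⟩⟩

/-- The one-dimensional representation `χ_s(T) = ∏_k t_{kk}^{2 s_k}`. -/
noncomputable def chi (s : Fin (r + 1) → ℝ) (T : Mat r n) : ℝ :=
  ∏ k : Fin (r + 1), tdiag T k ^ (2 * s k)

/-- `½ Σ_{i<k} ε_i dim 𝒱_{ki}`. -/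
noncomputable def xiBound (ε : Fin (r + 1) → Bool) (k : Fin (r + 1)) : ℝ :=
  (1 / 2) * ∑ i ∈ Finset.univ.filter (fun i => i < k),
    (if ε i then (Module.finrank ℝ (V k i) : ℝ) else 0)

/-- The Gindikin set `Ξ`. -/
def XiSet : Set (Fin (r + 1) → ℝ) :=
  ⋃ ε : Fin (r + 1) → Bool,
    {s | ∀ k, (ε k = true → xiBound V ε k < s k) ∧ (ε k = false → s k = xiBound V ε k)}

/-- `½ Σ_{l>k} ε_l dim 𝒱_{lk}`. -/
noncomputable def frakBound (ε : Fin (r + 1) → Bool) (k : Fin (r + 1)) : ℝ :=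
  (1 / 2) * ∑ l ∈ Finset.univ.filter (fun l => k < l),
    (if ε l then (Module.finrank ℝ (V l k) : ℝ) else 0)

/-- The Gindikin set `𝔛`. -/
def frakX : Set (Fin (r + 1) → ℝ) :=
  ⋃ ε : Fin (r + 1) → Bool,
    {s | ∀ k, (ε k = true → frakBound V ε k < s k) ∧ (ε k = false → s k = frakBound V ε k)}

/-- Laplace transform `L_μ(θ) = ∫ e^{-⟨θ,x⟩} dμ(x)` (with values in `[0,∞]`). -/
noncomputable def laplace (μ : Measure (Mat r n)) (θ : Mat r n) : ℝ≥0∞ :=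
  ∫⁻ x, ENNReal.ofReal (Real.exp (-(tip θ x))) ∂μ

/-- Real-valued Laplace transform. -/
noncomputable def laplaceR (μ : Measure (Mat r n)) (θ : Mat r n) : ℝ :=
  ∫ x, Real.exp (-(tip θ x)) ∂μ

/-- Mean of the natural-exponential-family member `P(θ,μ)`, computed entrywise:
`m_μ(θ) = L_μ(θ)⁻¹ ∫ x e^{-⟨θ,x⟩} dμ(x)`. -/
noncomputable def meanMap (μ : Measure (Mat r n)) (θ : Mat r n) : Mat r n :=
  Matrix.of fun p q => (laplaceR μ θ)⁻¹ * ∫ x, Real.exp (-(tip θ x)) * x p q ∂μ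

/-- Covariance operator of `P(θ,μ)` with mean `m`, applied to `ξ ∈ 𝒵` (entrywise):
`V ξ = ∫ ⟨ξ, x - m⟩ (x - m) dP(θ,μ)(x)`. -/
noncomputable def varOp (μ : Measure (Mat r n)) (θ m ξ : Mat r n) : Mat r n :=
  Matrix.of fun p q =>
    (laplaceR μ θ)⁻¹ * ∫ x, Real.exp (-(tip θ x)) * tip ξ (x - m) * ((x - m) p q) ∂μ

/-- Leading principal submatrix `y_{{1:k}}` consisting of the blocks with indices `≤ k`. -/
def lead (k : Fin (r + 1)) (y : Mat r n) :
    Matrix {p : Idx r n // p.1 ≤ k} {p : Idx r n // p.1 ≤ k} ℝ :=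
  Matrix.of fun p q => y p.1 q.1

/-- Zero-padding `z₀` of a matrix `z` defined on the blocks with indices `≤ k`. -/
def pad (k : Fin (r + 1)) (z : Matrix {p : Idx r n // p.1 ≤ k} {p : Idx r n // p.1 ≤ k} ℝ) :
    Mat r n :=
  Matrix.of fun p q => if h : p.1 ≤ k ∧ q.1 ≤ k then z ⟨p, h.1⟩ ⟨q, h.2⟩ else 0

/-- `J_k = (I_{N_k})₀`. -/
def Jmat (k : Fin (r + 1)) : Mat r n := pad k 1

/-- Parameters of elements of `W_i`: the scalar `x_{ii}` and the blocks `X_{li}`. -/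
abbrev Wparam (r : ℕ) (n : Fin (r + 1) → ℕ+) (i : Fin (r + 1)) :=
  ℝ × ∀ l : Fin (r + 1), Matrix (Fin (n l)) (Fin (n i)) ℝ

/-- The `N × n_i` matrix in `W_i` with `i`-th block row `x_{ii} I` and `l`-th block row
`X_{li}` for `l > i`. -/
def toW (i : Fin (r + 1)) (p : Wparam r n i) : Matrix (Idx r n) (Fin (n i)) ℝ :=
  Matrix.of fun q b =>
    if q.1 = i then (if (q.2 : ℕ) = (b : ℕ) then p.1 else 0)
    else if i < q.1 then p.2 q.1 q.2 b else 0

/-- A parameter tuple gives an honest element of `W_i`: blocks lie in `𝒱_{li}` and vanish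
for `l ≤ i`. -/
def WGood (i : Fin (r + 1)) (p : Wparam r n i) : Prop :=
  (∀ l : Fin (r + 1), i < l → p.2 l ∈ V l i) ∧ (∀ l : Fin (r + 1), ¬ i < l → p.2 l = 0)

/-- The inner product `(A|B)` on `𝒱_{lk}`, characterized by `(ABᵀ + BAᵀ)/2 = (A|B) I`. -/
noncomputable def bip (l : Fin (r + 1)) {k : Fin (r + 1)}
    (A B : Matrix (Fin (n l)) (Fin (n k)) ℝ) : ℝ :=
  (A * Bᵀ).trace / (n l : ℝ)

open scoped Classical in
/-- The generalized power function `Δ_s` on `𝒫`, defined by `Δ_s(ρ(T) I) = χ_s(T)`. -/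
noncomputable def DeltaDef (s : Fin (r + 1) → ℝ) (x : Mat r n) : ℝ :=
  if h : ∃ T, T ∈ Hgrp V ∧ x = rhoM T 1 then chi s h.choose else 0

/-- Index set for the block diagonal matrix `Φ(ξ) = diag(φ_0(ξ), …, φ_r(ξ))`,
where `φ_i(ξ)` is of size `m_i = mdc i + 1`. -/
abbrev DIdx (r : ℕ) (mdc : Fin (r + 1) → ℕ) := Σ i : Fin (r + 1), Fin (mdc i + 1)

/-- The block diagonal matrix `Φ(ξ) = diag(φ_0(ξ), …, φ_r(ξ))`. -/
def PhiMat {mdc : Fin (r + 1) → ℕ}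
    (φ : ∀ i : Fin (r + 1), Mat r n → Matrix (Fin (mdc i + 1)) (Fin (mdc i + 1)) ℝ)
    (ξ : Mat r n) : Matrix (DIdx r mdc) (DIdx r mdc) ℝ :=
  Matrix.of fun p q =>
    if h : p.1 = q.1 then φ p.1 ξ p.2 (Fin.cast (by rw [h]) q.2) else 0

/-- `Φ(I_N)^{-1/2}`: the inverse square root of the (diagonal, positive) matrix `Φ(I_N)`. -/
noncomputable def PhiISqrtInv {mdc : Fin (r + 1) → ℕ}
    (φ : ∀ i : Fin (r + 1), Mat r n → Matrix (Fin (mdc i + 1)) (Fin (mdc i + 1)) ℝ) :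
    Matrix (DIdx r mdc) (DIdx r mdc) ℝ :=
  Matrix.diagonal fun p => (PhiMat φ (1 : Mat r n) p p) ^ (-(1 / 2) : ℝ)

lemma blk_add (x y : Mat r n) (l k : Fin (r + 1)) : blk (x + y) l k = blk x l k + blk y l k := rfl

lemma blk_smul (c : ℝ) (x : Mat r n) (l k : Fin (r + 1)) : blk (c • x) l k = c • blk x l k := rfl

lemma blk_mul_transpose (x y : Mat r n) (l k : Fin (r + 1)) :
    blk (x * yᵀ) l k = ∑ j, blk x l j * (blk y k j)ᵀ := by
  ext a b
  simp [blk, Matrix.mul_apply, Fintype.sum_sigma, Matrix.sum_apply]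

lemma blk_diag_iff (x : Mat r n) (k : Fin (r + 1)) (c : ℝ) :
    (∀ a b : Fin (n k), x ⟨k, a⟩ ⟨k, b⟩ = if a = b then c else 0) ↔ blk x k k = c • 1 := by
  constructor
  · intro h
    ext a b
    simp [blk, h, Matrix.one_apply]
  · intro h a b
    have := congrFun (congrFun h a) b
    simpa [blk, Matrix.one_apply] using this

/-- The space `𝒵` as a submodule. -/
def Zsub : Submodule ℝ (Mat r n) where
  carrier := Zspace V
  add_mem' := by
    rintro x y ⟨hx1, hx2, hx3⟩ ⟨hy1, hy2, hy3⟩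
    refine ⟨hx1.add hy1, fun k l h => (V l k).add_mem (hx2 k l h) (hy2 k l h), fun k => ?_⟩
    obtain ⟨c, hc⟩ := hx3 k
    obtain ⟨d, hd⟩ := hy3 k
    refine ⟨c + d, (blk_diag_iff _ _ _).2 ?_⟩
    rw [blk_add, (blk_diag_iff _ _ _).1 hc, (blk_diag_iff _ _ _).1 hd, add_smul]
  zero_mem' := ⟨Matrix.isSymm_zero, fun k l _ => (V l k).zero_mem, fun k => ⟨0, by simp⟩⟩
  smul_mem' := by
    rintro a x ⟨hx1, hx2, hx3⟩
    refine ⟨hx1.smul a, fun k l h => (V l k).smul_mem a (hx2 k l h), fun k => ?_⟩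
    obtain ⟨c, hc⟩ := hx3 k
    refine ⟨a * c, (blk_diag_iff _ _ _).2 ?_⟩
    rw [blk_smul, (blk_diag_iff _ _ _).1 hc, smul_smul]

/-- The space of block lower triangular matrices with strictly lower blocks in `𝒱_{lk}` and
scalar diagonal blocks. -/
def lowSub : Submodule ℝ (Mat r n) where
  carrier := {T | (∀ k l : Fin (r + 1), l < k → blk T l k = 0) ∧
    (∀ k l : Fin (r + 1), k < l → blk T l k ∈ V l k) ∧
    ∀ k : Fin (r + 1), ∃ t : ℝ, ∀ a b : Fin (n k),
      T ⟨k, a⟩ ⟨k, b⟩ = if a = b then t else 0}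
  add_mem' := by
    rintro x y ⟨hx1, hx2, hx3⟩ ⟨hy1, hy2, hy3⟩
    refine ⟨fun k l h => by rw [blk_add, hx1 k l h, hy1 k l h, add_zero],
      fun k l h => (V l k).add_mem (hx2 k l h) (hy2 k l h), fun k => ?_⟩
    obtain ⟨c, hc⟩ := hx3 k
    obtain ⟨d, hd⟩ := hy3 k
    refine ⟨c + d, (blk_diag_iff _ _ _).2 ?_⟩
    rw [blk_add, (blk_diag_iff _ _ _).1 hc, (blk_diag_iff _ _ _).1 hd, add_smul]
  zero_mem' := ⟨fun k l _ => rfl, fun k l _ => (V l k).zero_mem, fun k => ⟨0, by simp⟩⟩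
  smul_mem' := by
    rintro a x ⟨hx1, hx2, hx3⟩
    refine ⟨fun k l h => by rw [blk_smul, hx1 k l h, smul_zero],
      fun k l h => (V l k).smul_mem a (hx2 k l h), fun k => ?_⟩
    obtain ⟨c, hc⟩ := hx3 k
    refine ⟨a * c, (blk_diag_iff _ _ _).2 ?_⟩
    rw [blk_smul, (blk_diag_iff _ _ _).1 hc, smul_smul]

lemma apply_diag_eq {T : Mat r n} {k : Fin (r + 1)}
    (h : ∃ t : ℝ, ∀ a b : Fin (n k), T ⟨k, a⟩ ⟨k, b⟩ = if a = b then t else 0)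
    (a b : Fin (n k)) : T ⟨k, a⟩ ⟨k, b⟩ = if a = b then tdiag T k else 0 := by
  obtain ⟨t, ht⟩ := h
  have : tdiag T k = t := by simp [tdiag, ht]
  rw [this, ht]

lemma mem_Hgrp_iff {T : Mat r n} : T ∈ Hgrp V ↔ T ∈ lowSub V ∧ ∀ k, 0 < tdiag T k := by
  constructor
  · rintro ⟨h1, h2, h3⟩
    refine ⟨⟨h1, h2, fun k => ?_⟩, fun k => ?_⟩
    · obtain ⟨t, -, ht⟩ := h3 k
      exact ⟨t, ht⟩
    · obtain ⟨t, ht0, ht⟩ := h3 k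
      simpa [tdiag, ht] using ht0
  · rintro ⟨⟨h1, h2, h3⟩, h4⟩
    exact ⟨h1, h2, fun k => ⟨_, h4 k, apply_diag_eq (h3 k)⟩⟩

lemma self_mul_transpose_mem (hV2 : CondV2 V) (hV3 : CondV3 V) {T : Mat r n}
    (hT : T ∈ lowSub V) : T * Tᵀ ∈ Zsub V := by
  obtain ⟨h1, h2, h3⟩ := hT
  have h3' : ∀ k, blk T k k = tdiag T k • 1 := fun k =>
    (blk_diag_iff _ _ _).1 (apply_diag_eq (h3 k))
  refine ⟨by simp [Matrix.IsSymm, Matrix.transpose_mul], fun k l hkl => ?_, fun k => ?_⟩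
  · rw [blk_mul_transpose]
    refine Submodule.sum_mem _ fun j _ => ?_
    rcases lt_trichotomy j k with hj | rfl | hj
    · exact hV2 j k l hj hkl _ (h2 _ _ (hj.trans hkl)) _ (h2 _ _ hj)
    · rw [h3' j]
      simpa using (V l j).smul_mem _ (h2 _ _ hkl)
    · rw [h1 _ _ hj]
      simp
  · have : ∀ j, ∃ c : ℝ, blk T k j * (blk T k j)ᵀ = c • 1 := fun j => by
      rcases lt_trichotomy j k with hj | rfl | hj
      · exact hV3 _ _ hj _ (h2 _ _ hj)
      · rw [h3' j]
        exact ⟨tdiag T j * tdiag T j, by simp [smul_smul]⟩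
      · rw [h1 _ _ hj]
        exact ⟨0, by simp⟩
    choose c hc using this
    refine ⟨∑ j, c j, (blk_diag_iff _ _ _).2 ?_⟩
    rw [blk_mul_transpose, Finset.sum_smul]
    exact Finset.sum_congr rfl fun j _ => hc j

/-- The matrix obtained from `y` by keeping only the `k`-th block column. -/
def colPart (k : Fin (r + 1)) (y : Mat r n) : Mat r n :=
  Matrix.of fun p q => if q.1 = k then y p q else 0

lemma colPart_apply (k : Fin (r + 1)) (y : Mat r n) (p q : Idx r n) :
    colPart k y p q = if q.1 = k then y p q else 0 := rfl

lemma colPart_apply_self (k : Fin (r + 1)) (y : Mat r n) (p : Idx r n) (a : Fin (n k)) :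
    colPart k y p ⟨k, a⟩ = y p ⟨k, a⟩ := by simp [colPart_apply]

lemma colPart_apply_ne {k j : Fin (r + 1)} (h : j ≠ k) (y : Mat r n) (p : Idx r n)
    (a : Fin (n j)) : colPart k y p ⟨j, a⟩ = 0 := by simp [colPart_apply, h]

lemma sum_colPart_mul (k : Fin (r + 1)) (y : Mat r n) (p : Idx r n) (f : Idx r n → ℝ) :
    ∑ q, colPart k y p q * f q = ∑ a : Fin (n k), y p ⟨k, a⟩ * f ⟨k, a⟩ := by
  rw [Fintype.sum_sigma, Finset.sum_eq_single k]
  · simp [colPart_apply]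
  · intro j _ hj
    simp [colPart_apply, hj]
  · simp

lemma colPart_mem_lowSub {y : Mat r n} {k : Fin (r + 1)} (hy : y ∈ Zsub V)
    (h0 : ∀ p q : Idx r n, p.1 < k → y p q = 0) : colPart k y ∈ lowSub V := by
  obtain ⟨-, h2, h3⟩ := hy
  refine ⟨fun j l hl => ?_, fun j l hl => ?_, fun j => ?_⟩
  · ext a b
    change colPart k y ⟨l, a⟩ ⟨j, b⟩ = 0
    rw [colPart_apply]
    split_ifs with h
    · exact h0 _ _ (by change l < k; rw [← (show j = k from h)]; exact hl)
    · rfl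
  · by_cases h : j = k
    · subst h
      convert h2 j l hl using 1
      ext a b
      exact colPart_apply_self _ _ _ _
    · convert (V l j).zero_mem using 1
      ext a b
      exact colPart_apply_ne h _ _ _
  · by_cases h : j = k
    · subst h
      obtain ⟨c, hc⟩ := h3 j
      exact ⟨c, fun a b => by rw [colPart_apply_self, hc]⟩
    · exact ⟨0, fun a b => by rw [colPart_apply_ne h]; simp⟩

lemma exists_partial_cholesky (hV2 : CondV2 V) (hV3 : CondV3 V) {θ : Mat r n}
    (hθ : θ ∈ Pcone V) (k : ℕ) (hk : k ≤ r + 1) :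
    ∃ T ∈ lowSub V, (∀ p q : Idx r n, k ≤ (q.1 : ℕ) → T p q = 0) ∧
      (∀ j : Fin (r + 1), (j : ℕ) < k → 0 < tdiag T j) ∧
      (∀ p q : Idx r n, (p.1 : ℕ) < k → (θ - T * Tᵀ) p q = 0) ∧
      ∀ v : Idx r n → ℝ, v ≠ 0 → (∀ p, (p.1 : ℕ) < k → v p = 0) →
        0 < v ⬝ᵥ (θ - T * Tᵀ) *ᵥ v := by
  induction k with
  | zero =>
    refine ⟨0, Submodule.zero_mem _, by simp, by simp, by simp, fun v hv _ => ?_⟩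
    simpa using hθ.2.dotProduct_mulVec_pos hv
  | succ k ih =>
    obtain ⟨T, hT, hT0, hTd, hy0, hypos⟩ := ih (by omega)
    obtain ⟨y, hy⟩ : ∃ y, y = θ - T * Tᵀ := ⟨_, rfl⟩
    rw [← hy] at hy0 hypos
    have hyZ : y ∈ Zsub V := by
      rw [hy]; exact Submodule.sub_mem _ hθ.1 (self_mul_transpose_mem V hV2 hV3 hT)
    have hys : ∀ p q, y p q = y q p := fun p q => hyZ.1.apply q p
    let κ : Fin (r + 1) := ⟨k, by omega⟩
    have hyd := apply_diag_eq (hyZ.2.2 κ)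
    set d := tdiag y κ with hd
    have hdpos : 0 < d := by
      have := hypos (Pi.single ⟨κ, ⟨0, (n κ).2⟩⟩ 1) (by simp) (fun p hp => by
        rw [Pi.single_apply, if_neg]
        rintro rfl
        exact absurd hp (lt_irrefl k))
      simpa [hyd] using this
    have hsd : (√d)⁻¹ * (√d)⁻¹ = d⁻¹ := by
      rw [← mul_inv, Real.mul_self_sqrt hdpos.le]
    obtain ⟨c, hc⟩ : ∃ c, c = (√d)⁻¹ • colPart κ y := ⟨_, rfl⟩
    have hcL : c ∈ lowSub V := by
      rw [hc]
      exact Submodule.smul_mem _ _ (colPart_mem_lowSub V hyZ fun p q hp => hy0 p q hp)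
    have hTc : T * cᵀ = 0 := by
      ext p p'
      rw [Matrix.mul_apply]
      refine Finset.sum_eq_zero fun q _ => ?_
      rw [hc, Matrix.transpose_apply, Matrix.smul_apply, colPart_apply]
      split_ifs with h
      · rw [hT0 p q (by rw [h]), zero_mul]
      · simp
    have hcT : c * Tᵀ = 0 := by
      have := congrArg Matrix.transpose hTc
      simpa [Matrix.transpose_mul] using this
    have hcc : ∀ p q, (c * cᵀ) p q = d⁻¹ * ∑ a : Fin (n κ), y p ⟨κ, a⟩ * y q ⟨κ, a⟩ := by
      intro p q
      rw [hc, Matrix.transpose_smul, Matrix.smul_mul, Matrix.mul_smul, smul_smul, hsd,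
        Matrix.smul_apply, Matrix.mul_apply, smul_eq_mul]
      simp only [Matrix.transpose_apply]
      rw [sum_colPart_mul]
      simp only [colPart_apply_self]
    have hy' : θ - (T + c) * (T + c)ᵀ = y - c * cᵀ := by
      rw [hy, Matrix.transpose_add, Matrix.add_mul, Matrix.mul_add, Matrix.mul_add, hTc, hcT]
      abel
    have hrow : ∀ p q : Idx r n, (p.1 : ℕ) < k + 1 → (y - c * cᵀ) p q = 0 := by
      intro p q hp
      rw [Matrix.sub_apply, hcc]
      rcases Nat.lt_succ_iff_lt_or_eq.1 hp with h | h
      · simp [hy0 p _ h]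
      · obtain ⟨j, b⟩ := p
        obtain rfl : j = κ := Fin.ext h
        simp only [hyd]
        simp only [ite_mul, zero_mul, Finset.sum_ite_eq, Finset.mem_univ, if_true]
        rw [hys q, inv_mul_cancel_left₀ hdpos.ne', sub_self]
    have hcol : ∀ p q : Idx r n, (q.1 : ℕ) < k + 1 → (y - c * cᵀ) p q = 0 := by
      intro p q hq
      have hs : (y - c * cᵀ).IsSymm := by
        rw [Matrix.IsSymm, Matrix.transpose_sub, Matrix.transpose_mul, Matrix.transpose_transpose,
          hyZ.1.eq]
      rw [← hs.apply]
      exact hrow q p hq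
    refine ⟨T + c, Submodule.add_mem _ hT hcL, fun p q hq => ?_, fun j hj => ?_, ?_, ?_⟩
    · have : q.1 ≠ κ := by
        rintro h
        rw [h] at hq
        exact absurd hq (by simp [κ])
      simp [hc, colPart_apply, this, hT0 p q (by omega)]
    · have e : tdiag (T + c) j = tdiag T j + tdiag c j := rfl
      rcases Nat.lt_succ_iff_lt_or_eq.1 hj with h | h
      · have hne : j ≠ κ := by rintro rfl; exact absurd h (lt_irrefl k)
        have : tdiag c j = 0 := by
          rw [hc, tdiag, Matrix.smul_apply, colPart_apply_ne hne, smul_zero]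
        rw [e, this, add_zero]
        exact hTd j h
      · obtain rfl : j = κ := Fin.ext h
        have h1 : tdiag T κ = 0 := hT0 _ _ le_rfl
        have h2 : tdiag c κ = (√d)⁻¹ * d := by
          rw [hc, tdiag, Matrix.smul_apply, colPart_apply_self, smul_eq_mul, hd, tdiag]
        rw [e, h1, h2, zero_add]
        have := Real.sqrt_pos.2 hdpos
        positivity
    · rw [hy']; exact hrow
    · rw [hy']
      intro w hw0 hw
      let z : Idx r n → ℝ := fun p => if p.1 = κ then -(d⁻¹ * (y *ᵥ w) p) else 0
      have hz : ∀ p : Idx r n, k + 1 ≤ (p.1 : ℕ) → z p = 0 := by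
        intro p hp
        refine if_neg fun h => ?_
        rw [h] at hp
        exact absurd hp (by simp [κ])
      have hyz : (y - c * cᵀ) *ᵥ z = 0 := by
        ext p
        refine Finset.sum_eq_zero fun q _ => ?_
        by_cases hq : (q.1 : ℕ) < k + 1
        · exact mul_eq_zero_of_left (hcol p q hq) _
        · exact mul_eq_zero_of_right _ (hz q (by omega))
      have hzy : ∀ u, z ⬝ᵥ ((y - c * cᵀ) *ᵥ u) = 0 := by
        intro u
        refine Finset.sum_eq_zero fun p _ => ?_
        by_cases hp : (p.1 : ℕ) < k + 1
        · refine mul_eq_zero_of_right _ (Finset.sum_eq_zero fun q _ => ?_)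
          exact mul_eq_zero_of_left (hrow p q hp) _
        · exact mul_eq_zero_of_left (hz p (by omega)) _
      have hcv : cᵀ *ᵥ (w + z) = 0 := by
        ext ⟨j, a⟩
        rw [Matrix.mulVec, dotProduct]
        simp only [Matrix.transpose_apply, Pi.zero_apply]
        by_cases hj : j = κ
        · subst hj
          simp only [hc, Matrix.smul_apply, colPart_apply_self, Pi.add_apply, smul_eq_mul, mul_add,
            Finset.sum_add_distrib, mul_assoc, ← Finset.mul_sum]
          rw [← mul_add]
          have h1 : ∑ i, y i ⟨κ, a⟩ * w i = (y *ᵥ w) ⟨κ, a⟩ := by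
            rw [Matrix.mulVec, dotProduct]
            exact Finset.sum_congr rfl fun i _ => by rw [hys]
          have h2 : ∑ i, y i ⟨κ, a⟩ * z i = -(y *ᵥ w) ⟨κ, a⟩ := by
            rw [Fintype.sum_sigma, Finset.sum_eq_single κ]
            · simp only [hyd, z, if_true]
              simp only [ite_mul, zero_mul, Finset.sum_ite_eq', Finset.mem_univ, if_true]
              field_simp
            · intro j _ hj
              simp [z, hj]
            · simp
          rw [h1, h2, add_neg_cancel, mul_zero]
        · exact Finset.sum_eq_zero fun p _ => by
            rw [hc, Matrix.smul_apply, colPart_apply_ne hj]; simp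
      have hpos := hypos (w + z) (fun h => hw0 (by
          ext p
          by_cases hp : (p.1 : ℕ) < k + 1
          · exact hw p hp
          · have := congrFun h p
            simpa [hz p (by omega)] using this)) (fun p hp => by
          rw [Pi.add_apply, hw p (by omega), zero_add]
          refine if_neg fun h => ?_
          rw [h] at hp
          exact absurd hp (lt_irrefl k))
      have e1 : (w + z) ⬝ᵥ y *ᵥ (w + z) = (w + z) ⬝ᵥ (y - c * cᵀ) *ᵥ (w + z) := by
        rw [Matrix.sub_mulVec, ← Matrix.mulVec_mulVec, hcv, Matrix.mulVec_zero, sub_zero]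
      rw [e1, Matrix.mulVec_add, hyz, add_zero, add_dotProduct, hzy, add_zero] at hpos
      exact hpos

/-- Cholesky decomposition: every element of `𝒫` is `T Tᵀ` with `T ∈ H`. -/
lemma exists_mem_Hgrp (hV2 : CondV2 V) (hV3 : CondV3 V) {θ : Mat r n}
    (hθ : θ ∈ Pcone V) : ∃ T ∈ Hgrp V, θ = T * Tᵀ := by
  obtain ⟨T, hT, -, hTd, h0, -⟩ := exists_partial_cholesky V hV2 hV3 hθ (r + 1) le_rfl
  refine ⟨T, (mem_Hgrp_iff V).2 ⟨hT, fun k => hTd k k.2⟩, ?_⟩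
  rw [← sub_eq_zero]
  ext p q
  exact h0 p q p.1.2

/-- If `A u` is a multiple of the first basis vector, then `A⁻¹` differs from the zero-padded
inverse of the lower right corner of `A` by a multiple of `u uᵀ`. -/
lemma trace_mul_inv_sub_trace_mul_inv {m : ℕ} {A : Matrix (Fin (m + 1)) (Fin (m + 1)) ℝ}
    (hA : A.PosDef) (B : Matrix (Fin (m + 1)) (Fin (m + 1)) ℝ) {u : Fin (m + 1) → ℝ} {σ s : ℝ}
    (hu : A *ᵥ u = Pi.single 0 σ) (hs : σ * u 0 = s) (hs0 : s ≠ 0) :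
    (B * A⁻¹).trace - (B.submatrix Fin.succ Fin.succ * (A.submatrix Fin.succ Fin.succ)⁻¹).trace
      = (u ⬝ᵥ B *ᵥ u) / s := by
  set C := A.submatrix Fin.succ Fin.succ with hC
  have hCpd : C.PosDef := hA.submatrix (Fin.succ_injective m)
  have hCu : IsUnit C.det := (Matrix.isUnit_iff_isUnit_det C).1 hCpd.isUnit
  have hAs : ∀ i j, A i j = A j i := fun i j => by simpa using hA.isHermitian.apply j i
  have hσ : σ ≠ 0 := fun h => hs0 (by rw [← hs, h, zero_mul])
  have hu0 : u 0 ≠ 0 := fun h => hs0 (by rw [← hs, h, mul_zero])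
  let b : Fin m → ℝ := fun i => A 0 i.succ
  let u' : Fin m → ℝ := fun i => u i.succ
  have hCu' : C *ᵥ u' = -(u 0) • b := by
    ext i
    have := congrFun hu i.succ
    rw [Matrix.mulVec, dotProduct, Fin.sum_univ_succ, Pi.single_eq_of_ne (Fin.succ_ne_zero i)] at this
    have e : (C *ᵥ u') i = ∑ j : Fin m, A i.succ j.succ * u j.succ := rfl
    rw [e, Pi.smul_apply, smul_eq_mul]
    have e2 : b i = A i.succ 0 := hAs _ _
    rw [e2]
    linarith
  have hu' : u' = -(u 0) • (C⁻¹ *ᵥ b) := by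
    rw [← Matrix.mulVec_smul, ← hCu', Matrix.mulVec_mulVec, Matrix.nonsing_inv_mul _ hCu,
      Matrix.one_mulVec]
  have hCinv : ∀ i j, C⁻¹ i j = C⁻¹ j i := fun i j => by
    simpa using hCpd.inv.isHermitian.apply j i
  let D : Matrix (Fin (m + 1)) (Fin (m + 1)) ℝ :=
    Matrix.of fun i j => Fin.cases 0 (fun i' => Fin.cases 0 (fun j' => C⁻¹ i' j') j) i
  have hD0 : ∀ j, D 0 j = 0 := fun j => rfl
  have hDs0 : ∀ i : Fin m, D i.succ 0 = 0 := fun i => rfl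
  have hDss : ∀ i j : Fin m, D i.succ j.succ = C⁻¹ i j := fun i j => rfl
  have hAinv : A⁻¹ = D + s⁻¹ • Matrix.vecMulVec u u := by
    refine Matrix.inv_eq_right_inv ?_
    rw [Matrix.mul_add, Matrix.mul_smul, Matrix.mul_vecMulVec, hu]
    ext i j
    rw [Matrix.add_apply, Matrix.mul_apply, Fin.sum_univ_succ, Matrix.smul_apply,
      Matrix.vecMulVec_apply, hD0, mul_zero, zero_add, smul_eq_mul]
    refine Fin.cases ?_ (fun i => ?_) i <;> refine Fin.cases ?_ (fun j => ?_) j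
    · simp [hDs0, hs, hs0]
    · have h1 : ∑ k : Fin m, A 0 k.succ * C⁻¹ k j = (C⁻¹ *ᵥ b) j :=
        Finset.sum_congr rfl fun k _ => by rw [hCinv, mul_comm]
      have h2 : u j.succ = -(u 0) * (C⁻¹ *ᵥ b) j := congrFun hu' j
      simp only [hDss, h1, Pi.single_eq_same, h2, ← hs, Matrix.one_apply,
        (Fin.succ_ne_zero j).symm, if_false]
      field_simp
      ring
    · simp [hDs0]
    · have h1 : ∑ k : Fin m, A i.succ k.succ * C⁻¹ k j = (1 : Matrix (Fin m) (Fin m) ℝ) i j := by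
        rw [← Matrix.mul_nonsing_inv _ hCu]; rfl
      simp [hDss, h1, Matrix.one_apply]
  have hBD : (B * D).trace = (B.submatrix Fin.succ Fin.succ * C⁻¹).trace := by
    simp only [Matrix.trace, Matrix.diag, Matrix.mul_apply, Fin.sum_univ_succ, hD0, hDs0, hDss,
      mul_zero, zero_add, Finset.sum_const_zero, Matrix.submatrix_apply]
  have hBu : (B * Matrix.vecMulVec u u).trace = u ⬝ᵥ B *ᵥ u := by
    rw [Matrix.mul_vecMulVec, Matrix.trace_vecMulVec, dotProduct_comm]
  rw [hAinv, Matrix.mul_add, Matrix.trace_add, hBD, Matrix.mul_smul, Matrix.trace_smul, hBu,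
    smul_eq_mul]
  ring

lemma tip_comm (x y : Mat r n) : tip x y = tip y x := Matrix.trace_mul_comm x y

lemma tip_add_right (x y z : Mat r n) : tip x (y + z) = tip x y + tip x z := by
  simp [tip, Matrix.mul_add]

lemma tip_sub_right (x y z : Mat r n) : tip x (y - z) = tip x y - tip x z := by
  simp [tip, Matrix.mul_sub]

lemma tip_smul_right (c : ℝ) (x y : Mat r n) : tip x (c • y) = c * tip x y := by
  simp [tip]

lemma tip_add_left (x y z : Mat r n) : tip (x + y) z = tip x z + tip y z := by
  simp [tip, Matrix.add_mul]

lemma tip_sub_left (x y z : Mat r n) : tip (x - y) z = tip x z - tip y z := by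
  simp [tip, Matrix.sub_mul]

lemma tip_smul_left (c : ℝ) (x y : Mat r n) : tip (c • x) y = c * tip x y := by
  simp [tip]

lemma tip_sum_right {ι : Type*} (t : Finset ι) (x : Mat r n) (f : ι → Mat r n) :
    tip x (∑ i ∈ t, f i) = ∑ i ∈ t, tip x (f i) := by
  simp [tip, Matrix.mul_sum, Matrix.trace_sum]

lemma tip_apply (x y : Mat r n) : tip x y = ∑ p, ∑ q, x p q * y q p := by
  simp [tip, Matrix.trace, Matrix.mul_apply]

lemma eq_zero_of_tip_self {x : Mat r n} (hx : x ∈ Zsub V) (h : tip x x = 0) : x = 0 := by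
  rw [← Matrix.trace_mul_conjTranspose_self_eq_zero_iff, Matrix.conjTranspose_eq_transpose_of_trivial,
    hx.1.eq]
  exact h

lemma eq_of_forall_tip {x y : Mat r n} (hx : x ∈ Zsub V) (hy : y ∈ Zsub V)
    (h : ∀ ξ ∈ Zsub V, tip ξ x = tip ξ y) : x = y := by
  have hxy := Submodule.sub_mem _ hx hy
  refine sub_eq_zero.1 (eq_zero_of_tip_self V hxy ?_)
  rw [tip_sub_right, h _ hxy, sub_self]

lemma exists_tip_eq_apply (p q : Idx r n) :
    ∃ y ∈ Zsub V, ∀ x ∈ Zsub V, tip y x = x p q := by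
  let B : Zsub V →ₗ[ℝ] Module.Dual ℝ (Zsub V) :=
    LinearMap.mk₂ ℝ (fun y x => tip (y : Mat r n) (x : Mat r n))
      (fun _ _ _ => tip_add_left _ _ _) (fun _ _ _ => tip_smul_left _ _ _)
      (fun _ _ _ => tip_add_right _ _ _) (fun _ _ _ => tip_smul_right _ _ _)
  have hinj : Function.Injective B := by
    rw [injective_iff_map_eq_zero]
    intro y hy
    exact Subtype.ext (eq_zero_of_tip_self V y.2 (LinearMap.congr_fun hy y))
  have hsurj : Function.Surjective B :=
    (LinearMap.injective_iff_surjective_of_finrank_eq_finrank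
      Subspace.dual_finrank_eq.symm).1 hinj
  obtain ⟨y, hy⟩ := hsurj ((Matrix.entryLinearMap ℝ ℝ p q).comp (Zsub V).subtype)
  exact ⟨y, y.2, fun x hx => LinearMap.congr_fun hy ⟨x, hx⟩⟩

lemma eventually_posDef_add_smul {ι : Type*} [Fintype ι] {A B : Matrix ι ι ℝ} (hA : A.PosDef)
    (hB : B.IsSymm) : ∀ᶠ t : ℝ in nhds 0, (A + t • B).PosDef := by
  have hK : IsCompact (Metric.sphere (0 : ι → ℝ) 1) := isCompact_sphere _ _
  have := hK.eventually_forall_of_forall_eventually (x₀ := (0 : ℝ))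
    (P := fun t v => 0 < v ⬝ᵥ (A + t • B) *ᵥ v) (fun v hv => by
      have hc : Continuous fun z : ℝ × (ι → ℝ) => z.2 ⬝ᵥ (A + z.1 • B) *ᵥ z.2 := by fun_prop
      refine hc.continuousAt.eventually (lt_mem_nhds ?_)
      have : v ≠ 0 := by rintro rfl; simp at hv
      simpa using hA.dotProduct_mulVec_pos this)
  filter_upwards [this] with t ht
  refine Matrix.PosDef.of_dotProduct_mulVec_pos ?_ fun {v} hv => ?_
  · have := hA.isHermitian
    rw [Matrix.IsHermitian, Matrix.conjTranspose_eq_transpose_of_trivial] at this ⊢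
    rw [Matrix.transpose_add, Matrix.transpose_smul, this, hB.eq]
  · have hn : 0 < ‖v‖ := norm_pos_iff.2 hv
    have h1 := ht (‖v‖⁻¹ • v) (by simp [norm_smul, hn.ne'])
    rw [Matrix.mulVec_smul, smul_dotProduct, dotProduct_smul, smul_eq_mul, smul_eq_mul,
      ← mul_assoc] at h1
    have h2 : 0 < ‖v‖⁻¹ * ‖v‖⁻¹ := by positivity
    simpa using (mul_pos_iff_of_pos_left h2).1 h1

lemma eventually_add_smul_mem_Pcone {θ y : Mat r n} (hθ : θ ∈ Pcone V) (hy : y ∈ Zsub V) :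
    ∀ᶠ t : ℝ in nhds 0, θ + t • y ∈ Pcone V := by
  filter_upwards [eventually_posDef_add_smul hθ.2 hy.1] with t ht
  exact ⟨(Zsub V).add_mem hθ.1 ((Zsub V).smul_mem t hy), ht⟩

lemma measurable_entry (p q : Idx r n) : Measurable fun x : Mat r n => x p q :=
  (measurable_pi_apply q).comp (measurable_pi_apply p)

lemma measurable_tip (θ : Mat r n) : Measurable fun x : Mat r n => tip θ x := by
  simp only [tip_apply]
  exact Finset.measurable_sum _ fun p _ => Finset.measurable_sum _ fun q _ =>
    (measurable_entry q p).const_mul _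

lemma measurable_exp_neg_tip (θ : Mat r n) :
    Measurable fun x : Mat r n => Real.exp (-(tip θ x)) :=
  Real.measurable_exp.comp (measurable_tip θ).neg

section Laplace

variable {V} {μ : Measure (Mat r n)} {g : Mat r n → ℝ}

lemma integrable_exp_neg_tip (hμL : ∀ θ ∈ Pcone V, laplace μ θ = ENNReal.ofReal (g θ))
    {θ : Mat r n} (hθ : θ ∈ Pcone V) : Integrable (fun x => Real.exp (-(tip θ x))) μ := by
  refine ⟨(measurable_exp_neg_tip θ).aestronglyMeasurable, ?_⟩
  rw [hasFiniteIntegral_iff_ofReal (Filter.Eventually.of_forall fun x => (Real.exp_pos _).le)]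
  exact (hμL θ hθ).trans_lt ENNReal.ofReal_lt_top

lemma laplaceR_eq (hμL : ∀ θ ∈ Pcone V, laplace μ θ = ENNReal.ofReal (g θ))
    (hg : ∀ θ ∈ Pcone V, 0 < g θ) {θ : Mat r n} (hθ : θ ∈ Pcone V) : laplaceR μ θ = g θ := by
  rw [laplaceR, integral_eq_lintegral_of_nonneg_ae
    (Filter.Eventually.of_forall fun x => (Real.exp_pos _).le)
    (measurable_exp_neg_tip θ).aestronglyMeasurable]
  change (laplace μ θ).toReal = _
  rw [hμL θ hθ, ENNReal.toReal_ofReal (hg θ hθ).le]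

lemma integrable_exp_neg_tip_mul_entry (hμsupp : μ (Zspace V)ᶜ = 0)
    (hμL : ∀ θ ∈ Pcone V, laplace μ θ = ENNReal.ofReal (g θ))
    {θ : Mat r n} (hθ : θ ∈ Pcone V) (p q : Idx r n) :
    Integrable (fun x => Real.exp (-(tip θ x)) * x p q) μ := by
  obtain ⟨y, hy, hyx⟩ := exists_tip_eq_apply V p q
  obtain ⟨δ, hδ, h⟩ := Metric.eventually_nhds_iff.1 (eventually_add_smul_mem_Pcone V hθ hy)
  have hε : 0 < δ / 2 := by positivity
  have h1 := h (y := δ / 2) (by rw [Real.dist_0_eq_abs, abs_of_pos hε]; linarith)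
  have h2 := h (y := -(δ / 2)) (by rw [Real.dist_0_eq_abs, abs_neg, abs_of_pos hε]; linarith)
  set ε := δ / 2
  refine Integrable.mono' (((integrable_exp_neg_tip hμL h1).add
    (integrable_exp_neg_tip hμL h2)).const_mul ε⁻¹)
    ((measurable_exp_neg_tip θ).mul (measurable_entry p q)).aestronglyMeasurable ?_
  have hae : ∀ᵐ x ∂μ, x ∈ Zspace V := by
    rw [ae_iff]
    exact hμsupp
  filter_upwards [hae] with x hx
  rw [← hyx x hx, Real.norm_eq_abs, abs_mul, abs_of_pos (Real.exp_pos _)]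
  simp only [Pi.add_apply, tip_add_left, tip_smul_left, neg_add, Real.exp_add, neg_mul, neg_neg]
  rw [← mul_add, mul_left_comm]
  refine mul_le_mul_of_nonneg_left ?_ (Real.exp_pos _).le
  rw [inv_mul_eq_div, le_div_iff₀ hε, mul_comm]
  have a1 := Real.add_one_le_exp (ε * tip y x)
  have a2 := Real.add_one_le_exp (-(ε * tip y x))
  have a3 := Real.exp_pos (ε * tip y x)
  have a4 := Real.exp_pos (-(ε * tip y x))
  rw [← abs_of_pos hε, ← abs_mul, abs_of_pos hε]
  exact abs_le.2 ⟨by linarith, by linarith⟩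

lemma exp_mul_tip_eq_sum (θ z x : Mat r n) : Real.exp (-(tip θ x)) * tip z x
    = ∑ p, ∑ q, z p q * (Real.exp (-(tip θ x)) * x q p) := by
  rw [tip_apply z x, Finset.mul_sum]
  refine Finset.sum_congr rfl fun p _ => ?_
  rw [Finset.mul_sum]
  exact Finset.sum_congr rfl fun q _ => mul_left_comm _ _ _

lemma integrable_exp_neg_tip_mul_tip (hμsupp : μ (Zspace V)ᶜ = 0)
    (hμL : ∀ θ ∈ Pcone V, laplace μ θ = ENNReal.ofReal (g θ))
    {θ : Mat r n} (hθ : θ ∈ Pcone V) (z : Mat r n) :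
    Integrable (fun x => Real.exp (-(tip θ x)) * tip z x) μ := by
  simp only [exp_mul_tip_eq_sum]
  exact integrable_finsetSum _ fun p _ => integrable_finsetSum _ fun q _ =>
    (integrable_exp_neg_tip_mul_entry hμsupp hμL hθ q p).const_mul _

lemma integral_exp_neg_tip_mul_tip (hμsupp : μ (Zspace V)ᶜ = 0)
    (hμL : ∀ θ ∈ Pcone V, laplace μ θ = ENNReal.ofReal (g θ)) (hg : ∀ θ ∈ Pcone V, 0 < g θ)
    {θ : Mat r n} (hθ : θ ∈ Pcone V) (z : Mat r n) :
    ∫ x, Real.exp (-(tip θ x)) * tip z x ∂μ = g θ * tip z (meanMap μ θ) := by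
  have hi : ∀ p q, Integrable (fun x => z p q * (Real.exp (-(tip θ x)) * x q p)) μ := fun p q =>
    (integrable_exp_neg_tip_mul_entry hμsupp hμL hθ q p).const_mul _
  calc ∫ x, Real.exp (-(tip θ x)) * tip z x ∂μ
      = ∫ x, ∑ p, ∑ q, z p q * (Real.exp (-(tip θ x)) * x q p) ∂μ :=
        integral_congr_ae (Filter.Eventually.of_forall fun x => exp_mul_tip_eq_sum θ z x)
    _ = ∑ p, ∑ q, ∫ x, z p q * (Real.exp (-(tip θ x)) * x q p) ∂μ :=
        (integral_finsetSum _ fun p _ => integrable_finsetSum _ fun q _ => hi p q).trans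
          (Finset.sum_congr rfl fun p _ => integral_finsetSum _ fun q _ => hi p q)
    _ = g θ * tip z (meanMap μ θ) := by
        rw [tip_apply, Finset.mul_sum]
        refine Finset.sum_congr rfl fun p _ => ?_
        rw [Finset.mul_sum]
        refine Finset.sum_congr rfl fun q _ => ?_
        rw [integral_const_mul, meanMap, Matrix.of_apply, laplaceR_eq hμL hg hθ]
        have := (hg θ hθ).ne'
        field_simp

/-- First-order convexity inequality for the Laplace transform. -/
lemma mul_one_sub_tip_mean_le (hμsupp : μ (Zspace V)ᶜ = 0)
    (hμL : ∀ θ ∈ Pcone V, laplace μ θ = ENNReal.ofReal (g θ)) (hg : ∀ θ ∈ Pcone V, 0 < g θ)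
    {θ θ' : Mat r n} (hθ : θ ∈ Pcone V) (hθ' : θ' ∈ Pcone V) :
    g θ * (1 - tip (θ' - θ) (meanMap μ θ)) ≤ g θ' := by
  have h1 := integrable_exp_neg_tip hμL hθ
  have h2 := integrable_exp_neg_tip_mul_tip hμsupp hμL hθ (θ' - θ)
  have e1 : ∫ x, Real.exp (-(tip θ x)) ∂μ = g θ := laplaceR_eq hμL hg hθ
  have e2 : ∫ x, Real.exp (-(tip θ' x)) ∂μ = g θ' := laplaceR_eq hμL hg hθ'
  rw [mul_sub, mul_one, ← integral_exp_neg_tip_mul_tip hμsupp hμL hg hθ, ← e1, ← e2,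
    ← integral_sub h1 h2]
  refine integral_mono (h1.sub h2) (integrable_exp_neg_tip hμL hθ') fun x => ?_
  have e : -(tip θ' x) = -(tip θ x) + -(tip (θ' - θ) x) := by rw [tip_sub_left]; ring
  have := Real.add_one_le_exp (-(tip (θ' - θ) x))
  have h0 := Real.exp_pos (-(tip θ x))
  simp only
  rw [e, Real.exp_add]
  nlinarith

end Laplace

lemma chi_eq_exp {T : Mat r n} (hT : ∀ k, 0 < tdiag T k) (s : Fin (r + 1) → ℝ) :
    chi s T = Real.exp (∑ k, 2 * s k * Real.log (tdiag T k)) := by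
  rw [chi, Real.exp_sum]
  refine Finset.prod_congr rfl fun k _ => ?_
  rw [Real.rpow_def_of_pos (hT k), mul_comm]

lemma mul_transpose_mem_Pcone (hV2 : CondV2 V) (hV3 : CondV3 V) {T : Mat r n}
    (hT : T ∈ lowSub V) (hpd : (T * Tᵀ).PosDef) : T * Tᵀ ∈ Pcone V :=
  ⟨self_mul_transpose_mem V hV2 hV3 hT, hpd⟩

/-- The stationarity equations satisfied by the mean of the exponential family at `T Tᵀ`. -/
lemma tip_mean_symm (hV2 : CondV2 V) (hV3 : CondV3 V)
    {Δf : (Fin (r + 1) → ℝ) → Mat r n → ℝ}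
    (hΔ : ∀ s : Fin (r + 1) → ℝ, ∀ T ∈ Hgrp V, Δf s (rhoM T 1) = chi s T)
    {s : Fin (r + 1) → ℝ} {μ : Measure (Mat r n)} (hμsupp : μ (Zspace V)ᶜ = 0)
    (hμL : ∀ θ ∈ Pcone V, laplace μ θ = ENNReal.ofReal (Δf (-s) θ))
    {T K : Mat r n} (hT : T ∈ Hgrp V) (hθ : T * Tᵀ ∈ Pcone V) (hK : K ∈ lowSub V) :
    tip (meanMap μ (T * Tᵀ)) (K * Tᵀ + T * Kᵀ)
      = 2 * ∑ k, s k * (tdiag K k / tdiag T k) := by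
  have hΔ' : ∀ T ∈ Hgrp V, Δf (-s) (T * Tᵀ) = chi (-s) T := fun T hT => by
    rw [← hΔ _ T hT, rhoM, Matrix.mul_one]
  have hg : ∀ θ ∈ Pcone V, 0 < Δf (-s) θ := by
    intro θ hθ
    obtain ⟨S, hS, rfl⟩ := exists_mem_Hgrp V hV2 hV3 hθ
    rw [hΔ' S hS, chi_eq_exp ((mem_Hgrp_iff V).1 hS).2]
    exact Real.exp_pos _
  obtain ⟨hTl, hTd⟩ := (mem_Hgrp_iff V).1 hT
  set m := meanMap μ (T * Tᵀ) with hm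
  have hcurve : ∀ t : ℝ, (T + t • K) * (T + t • K)ᵀ - T * Tᵀ
      = t • (K * Tᵀ + T * Kᵀ) + t ^ 2 • (K * Kᵀ) := by
    intro t
    simp only [Matrix.transpose_add, Matrix.transpose_smul, Matrix.add_mul, Matrix.mul_add,
      Matrix.smul_mul, Matrix.mul_smul, smul_add, smul_smul, pow_two]
    abel
  set a := tip m (K * Tᵀ + T * Kᵀ) with ha
  set b := tip m (K * Kᵀ) with hb
  have hmem : ∀ᶠ t : ℝ in nhds 0, T + t • K ∈ Hgrp V := by
    have : ∀ᶠ t : ℝ in nhds 0, ∀ k, 0 < tdiag T k + t * tdiag K k := by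
      refine Filter.eventually_all.2 fun k => ?_
      have hc : Continuous fun t : ℝ => tdiag T k + t * tdiag K k := by fun_prop
      exact hc.continuousAt.eventually (lt_mem_nhds (by simpa using hTd k))
    filter_upwards [this] with t ht
    exact (mem_Hgrp_iff V).2 ⟨Submodule.add_mem _ hTl (Submodule.smul_mem _ _ hK), ht⟩
  have hdet : IsUnit T := by
    have h := hθ.2.isUnit
    rw [Matrix.isUnit_iff_isUnit_det, Matrix.det_mul] at h
    exact (Matrix.isUnit_iff_isUnit_det _).2 (isUnit_of_mul_isUnit_left h)
  have hpd : ∀ᶠ t : ℝ in nhds 0, ((T + t • K) * (T + t • K)ᵀ).PosDef := by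
    have hc : Continuous fun t : ℝ => (T + t • K).det := by fun_prop
    have h0 : (T + (0 : ℝ) • K).det ≠ 0 := by
      simpa using ((Matrix.isUnit_iff_isUnit_det _).1 hdet).ne_zero
    filter_upwards [hc.continuousAt.eventually_ne h0] with t ht
    have hu : IsUnit (T + t • K) :=
      (Matrix.isUnit_iff_isUnit_det _).2 (isUnit_iff_ne_zero.2 ht)
    rw [← Matrix.conjTranspose_eq_transpose_of_trivial]
    exact Matrix.PosDef.mul_conjTranspose_self _ (Matrix.vecMul_injective_of_isUnit hu)
  let F : ℝ → ℝ := fun t =>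
    Real.exp (∑ k, 2 * (-s) k * Real.log (tdiag T k + t * tdiag K k))
      - chi (-s) T * (1 - (t * a + t ^ 2 * b))
  have hF0 : F 0 = 0 := by
    simp only [F, zero_mul, add_zero]
    rw [chi_eq_exp hTd]
    ring
  have hmin : IsLocalMin F 0 := by
    filter_upwards [hmem, hpd] with t ht htp
    rw [hF0]
    have h1 := mul_one_sub_tip_mean_le hμsupp hμL hg hθ
      (mul_transpose_mem_Pcone V hV2 hV3 ((mem_Hgrp_iff V).1 ht).1 htp)
    rw [hΔ' _ hT, hΔ' _ ht, hcurve, tip_comm, tip_add_right, tip_smul_right, tip_smul_right,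
      ← hm, ← ha, ← hb, chi_eq_exp ((mem_Hgrp_iff V).1 ht).2] at h1
    exact sub_nonneg.2 h1
  have hder : HasDerivAt F (chi (-s) T * (∑ k, 2 * (-s) k * (tdiag K k / tdiag T k))
      + chi (-s) T * a) 0 := by
    have h1 : HasDerivAt (fun t : ℝ => ∑ k, 2 * (-s) k * Real.log (tdiag T k + t * tdiag K k))
        (∑ k, 2 * (-s) k * (tdiag K k / tdiag T k)) 0 := by
      refine HasDerivAt.fun_sum fun k _ => HasDerivAt.const_mul _ ?_
      have h2 : HasDerivAt (fun t : ℝ => tdiag T k + t * tdiag K k) (tdiag K k) 0 := by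
        simpa using ((hasDerivAt_id (0 : ℝ)).mul_const (tdiag K k)).const_add (tdiag T k)
      simpa using h2.log (by simpa using (hTd k).ne')
    have h3 : HasDerivAt (fun t : ℝ => chi (-s) T * (1 - (t * a + t ^ 2 * b)))
        (-(chi (-s) T * a)) 0 := by
      have h4 := ((((hasDerivAt_id (0 : ℝ)).mul_const a).add
        ((hasDerivAt_pow 2 (0 : ℝ)).mul_const b)).const_sub 1).const_mul (chi (-s) T)
      exact h4.congr_deriv (by simp)
    have h5 := h1.exp.sub h3
    exact h5.congr_deriv (by rw [chi_eq_exp hTd]; simp)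
  have hz := hmin.hasDerivAt_eq_zero hder
  have hχ : chi (-s) T ≠ 0 := by
    rw [chi_eq_exp hTd]
    exact (Real.exp_pos _).ne'
  rw [← mul_add] at hz
  have hz' := (mul_eq_zero.1 hz).resolve_left hχ
  have e : ∑ k, 2 * (-s) k * (tdiag K k / tdiag T k)
      = -(2 * ∑ k, s k * (tdiag K k / tdiag T k)) := by
    rw [Finset.mul_sum, ← Finset.sum_neg_distrib]
    refine Finset.sum_congr rfl fun k _ => ?_
    rw [Pi.neg_apply]
    ring
  rw [e] at hz'
  linarith

lemma toW_apply_self (i : Fin (r + 1)) (p : Wparam r n i) (a b : Fin (n i)) :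
    toW i p ⟨i, a⟩ b = if a = b then p.1 else 0 := by
  simp [toW, Fin.ext_iff]

lemma toW_apply_gt {i l : Fin (r + 1)} (h : i < l) (p : Wparam r n i) (a : Fin (n l))
    (b : Fin (n i)) : toW i p ⟨l, a⟩ b = p.2 l a b := by
  simp [toW, h, h.ne']

lemma toW_apply_lt {i l : Fin (r + 1)} (h : l < i) (p : Wparam r n i) (a : Fin (n l))
    (b : Fin (n i)) : toW i p ⟨l, a⟩ b = 0 := by
  simp [toW, h.ne, not_lt.2 h.le]

lemma toW_add (i : Fin (r + 1)) (p p' : Wparam r n i) :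
    toW i (p + p') = toW i p + toW i p' := by
  ext ⟨l, a⟩ b
  rw [Matrix.add_apply]
  rcases lt_trichotomy l i with h | rfl | h
  · simp [toW_apply_lt h]
  · simp only [toW_apply_self]
    split_ifs <;> simp
  · simp [toW_apply_gt h]

lemma WGood.add {i : Fin (r + 1)} {p p' : Wparam r n i} (hp : WGood V i p) (hp' : WGood V i p') :
    WGood V i (p + p') :=
  ⟨fun l h => (V l i).add_mem (hp.1 l h) (hp'.1 l h), fun l h => by
    rw [Prod.snd_add, Pi.add_apply, hp.2 l h, hp'.2 l h, add_zero]⟩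

lemma WGood.eq_zero {i : Fin (r + 1)} {p : Wparam r n i} (hp : WGood V i p)
    (h : toW i p = 0) : p = 0 := by
  refine Prod.ext ?_ (funext fun l => ?_)
  · simpa [h] using (toW_apply_self i p ⟨0, (n i).2⟩ ⟨0, (n i).2⟩).symm
  · by_cases hl : i < l
    · ext a b
      simpa [h] using (toW_apply_gt hl p a b).symm
    · exact hp.2 l hl

/-- The `N × N` matrix whose `i`-th block column is `toW i p` and whose other entries vanish. -/
def fullW (i : Fin (r + 1)) (p : Wparam r n i) : Mat r n :=
  Matrix.of fun q j => if h : j.1 = i then toW i p q (h ▸ j.2) else 0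

lemma fullW_apply_self (i : Fin (r + 1)) (p : Wparam r n i) (q : Idx r n) (b : Fin (n i)) :
    fullW i p q ⟨i, b⟩ = toW i p q b := by simp [fullW]

lemma fullW_apply_ne {i j : Fin (r + 1)} (h : j ≠ i) (p : Wparam r n i) (q : Idx r n)
    (b : Fin (n j)) : fullW i p q ⟨j, b⟩ = 0 := by simp [fullW, h]

lemma fullW_mul_transpose (i : Fin (r + 1)) (p : Wparam r n i) (x : Mat r n)
    (w : Matrix (Idx r n) (Fin (n i)) ℝ) (hw : ∀ q b, x q ⟨i, b⟩ = w q b) :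
    fullW i p * xᵀ = toW i p * wᵀ := by
  ext q q'
  rw [Matrix.mul_apply, Matrix.mul_apply, Fintype.sum_sigma, Finset.sum_eq_single i]
  · simp [fullW_apply_self, hw]
  · intro j _ hj
    simp [fullW_apply_ne hj]
  · simp

lemma fullW_mem_lowSub {i : Fin (r + 1)} {p : Wparam r n i} (hp : WGood V i p) :
    fullW i p ∈ lowSub V := by
  refine ⟨fun j l hl => ?_, fun j l hl => ?_, fun j => ?_⟩
  · ext a b
    change fullW i p ⟨l, a⟩ ⟨j, b⟩ = 0
    by_cases h : j = i
    · subst h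
      rw [fullW_apply_self, toW_apply_lt hl]
    · rw [fullW_apply_ne h]
  · by_cases h : j = i
    · subst h
      convert hp.1 l hl using 1
      ext a b
      exact (fullW_apply_self _ _ _ _).trans (toW_apply_gt hl _ _ _)
    · convert (V l j).zero_mem using 1
      ext a b
      exact fullW_apply_ne h _ _ _
  · by_cases h : j = i
    · subst h
      exact ⟨p.1, fun a b => by rw [fullW_apply_self, toW_apply_self]⟩
    · exact ⟨0, fun a b => by rw [fullW_apply_ne h]; simp⟩

lemma tdiag_fullW (i : Fin (r + 1)) (p : Wparam r n i) (k : Fin (r + 1)) :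
    tdiag (fullW i p) k = if k = i then p.1 else 0 := by
  split_ifs with h
  · subst h
    rw [tdiag, fullW_apply_self, toW_apply_self, if_pos rfl]
  · rw [tdiag, fullW_apply_ne h]

/-- The parameters of the `i`-th block column of a block lower triangular matrix. -/
def colParam (T : Mat r n) (i : Fin (r + 1)) : Wparam r n i :=
  (tdiag T i, fun l => if i < l then blk T l i else 0)

lemma colParam_good {T : Mat r n} (hT : T ∈ lowSub V) (i : Fin (r + 1)) :
    WGood V i (colParam T i) :=
  ⟨fun l h => by simpa [colParam, h] using hT.2.1 i l h, fun l h => by simp [colParam, h]⟩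

lemma toW_colParam {T : Mat r n} (hT : T ∈ lowSub V) (i : Fin (r + 1)) (q : Idx r n)
    (b : Fin (n i)) : T q ⟨i, b⟩ = toW i (colParam T i) q b := by
  obtain ⟨l, a⟩ := q
  rcases lt_trichotomy l i with h | rfl | h
  · rw [toW_apply_lt h]
    exact congrFun (congrFun (hT.1 i l h) a) b
  · rw [toW_apply_self, apply_diag_eq (hT.2.2 l)]
    rfl
  · rw [toW_apply_gt h]
    simp [colParam, h, blk]

lemma sum_toW_colParam {T : Mat r n} (hT : T ∈ lowSub V) :
    ∑ i, toW i (colParam T i) * (toW i (colParam T i))ᵀ = T * Tᵀ := by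
  ext q q'
  rw [Matrix.sum_apply, Matrix.mul_apply, Fintype.sum_sigma]
  refine Finset.sum_congr rfl fun i _ => ?_
  rw [Matrix.mul_apply]
  simp only [Matrix.transpose_apply, toW_colParam V hT]

lemma one_mem_Pcone : (1 : Mat r n) ∈ Pcone V := by
  refine ⟨⟨Matrix.isSymm_one, fun k l h => ?_, fun k => ⟨1, fun a b => ?_⟩⟩, Matrix.PosDef.one⟩
  · convert (V l k).zero_mem using 1
    ext a b
    simp [blk, h.ne']
  · simp [Matrix.one_apply]

lemma self_mul_transpose_mem_closure (hV2 : CondV2 V) (hV3 : CondV3 V) {X : Mat r n}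
    (hX : X ∈ lowSub V) : X * Xᵀ ∈ closure (Pcone V) := by
  have hps : (X * Xᵀ).PosSemidef := by
    rw [← Matrix.conjTranspose_eq_transpose_of_trivial]
    exact Matrix.posSemidef_self_mul_conjTranspose X
  have ht : Filter.Tendsto (fun ε : ℝ => X * Xᵀ + ε • (1 : Mat r n)) (nhdsWithin 0 (Set.Ioi 0))
      (nhds (X * Xᵀ)) := by
    have hc : Continuous fun ε : ℝ => X * Xᵀ + ε • (1 : Mat r n) := by fun_prop
    have := (hc.tendsto 0).mono_left (nhdsWithin_le_nhds (s := Set.Ioi (0 : ℝ)))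
    simpa using this
  refine mem_closure_of_tendsto ht ?_
  filter_upwards [self_mem_nhdsWithin] with ε hε
  exact ⟨(Zsub V).add_mem (self_mul_transpose_mem V hV2 hV3 hX)
    ((Zsub V).smul_mem ε (one_mem_Pcone V).1),
    Matrix.PosDef.posSemidef_add hps (Matrix.PosDef.one.smul hε)⟩

lemma eq_of_isSymm_of_quadratic_eq {ι : Type*} [Fintype ι] [DecidableEq ι] {A B : Matrix ι ι ℝ}
    (hA : A.IsSymm) (hB : B.IsSymm) (h : ∀ v, v ⬝ᵥ A *ᵥ v = v ⬝ᵥ B *ᵥ v) : A = B := by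
  ext i j
  have hi := h (Pi.single i 1)
  have hj := h (Pi.single j 1)
  have hij := h (Pi.single i 1 + Pi.single j 1)
  have hA' := hA.apply i j
  have hB' := hB.apply i j
  simp only [Matrix.mulVec_add, add_dotProduct, dotProduct_add, Matrix.mulVec_single_one,
    single_one_dotProduct, Matrix.col_apply] at hi hj hij
  linarith

section Coordinates

variable {V} {i : Fin (r + 1)} {M : ℕ} {vc : Wparam r n i → (Fin (M + 1) → ℝ)}

lemma two_mul_dotProduct_mulVec (hlin : IsLinearMap ℝ vc) {ξ : Mat r n}
    {A : Matrix (Fin (M + 1)) (Fin (M + 1)) ℝ} (hA : A.IsSymm)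
    (hq : ∀ p, WGood V i p → vc p ⬝ᵥ A *ᵥ vc p = tip ξ (toW i p * (toW i p)ᵀ))
    {p p' : Wparam r n i} (hp : WGood V i p) (hp' : WGood V i p') :
    2 * (vc p ⬝ᵥ A *ᵥ vc p') = tip ξ (toW i p * (toW i p')ᵀ + toW i p' * (toW i p)ᵀ) := by
  have h1 := hq p hp
  have h2 := hq p' hp'
  have h3 := hq _ (hp.add V hp')
  have hs : vc p' ⬝ᵥ A *ᵥ vc p = vc p ⬝ᵥ A *ᵥ vc p' := by
    rw [Matrix.dotProduct_mulVec, ← Matrix.mulVec_transpose, hA.eq, dotProduct_comm]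
  simp only [hlin.map_add, toW_add, Matrix.mulVec_add, add_dotProduct, dotProduct_add,
    Matrix.transpose_add, Matrix.add_mul, Matrix.mul_add, tip_add_right] at h3 ⊢
  linarith

lemma posDef_of_mem_Qcone (hV2 : CondV2 V) (hV3 : CondV3 V) (hlin : IsLinearMap ℝ vc)
    (hsurj : ∀ v, ∃ p, WGood V i p ∧ vc p = v) {m : Mat r n} (hm : m ∈ Qcone V)
    {A : Matrix (Fin (M + 1)) (Fin (M + 1)) ℝ} (hA : A.IsSymm)
    (hq : ∀ p, WGood V i p → vc p ⬝ᵥ A *ᵥ vc p = tip m (toW i p * (toW i p)ᵀ)) :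
    A.PosDef := by
  refine Matrix.PosDef.of_dotProduct_mulVec_pos hA fun {v} hv => ?_
  obtain ⟨p, hp, rfl⟩ := hsurj v
  rw [star_trivial, hq p hp]
  have hX := fullW_mul_transpose i p (fullW i p) _ (fullW_apply_self i p)
  rw [← hX]
  refine hm.2 _ (self_mul_transpose_mem_closure V hV2 hV3 (fullW_mem_lowSub V hp)) fun h0 => ?_
  rw [← Matrix.conjTranspose_eq_transpose_of_trivial,
    Matrix.self_mul_conjTranspose_eq_zero] at h0
  refine hv ?_
  rw [hp.eq_zero V (by ext q b; rw [← fullW_apply_self, h0]; rfl), hlin.map_zero]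

lemma eq_submatrix_succ (hvc0 : ∀ p, WGood V i p → vc p 0 = p.1)
    (hsurj : ∀ v, ∃ p, WGood V i p ∧ vc p = v) {ξ : Mat r n}
    {A : Matrix (Fin (M + 1)) (Fin (M + 1)) ℝ} (hA : A.IsSymm)
    (hq : ∀ p, WGood V i p → vc p ⬝ᵥ A *ᵥ vc p = tip ξ (toW i p * (toW i p)ᵀ))
    {C : Matrix (Fin M) (Fin M) ℝ} (hC : C.IsSymm)
    (hqc : ∀ p, WGood V i p → p.1 = 0 → (fun j => vc p j.succ) ⬝ᵥ C *ᵥ (fun j => vc p j.succ)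
      = tip ξ (toW i p * (toW i p)ᵀ)) :
    C = A.submatrix Fin.succ Fin.succ := by
  refine eq_of_isSymm_of_quadratic_eq hC (hA.submatrix _) fun v => ?_
  obtain ⟨p, hp, hpv⟩ := hsurj (Fin.cons 0 v)
  have h0 : p.1 = 0 := by rw [← hvc0 p hp, hpv, Fin.cons_zero]
  have h1 := hqc p hp h0
  rw [← hq p hp] at h1
  simp only [hpv, Fin.cons_succ] at h1
  rw [h1]
  simp [dotProduct, Matrix.mulVec, Fin.sum_univ_succ]

end Coordinates

lemma mulVec_vc_colParam {i : Fin (r + 1)} {M : ℕ} {vc : Wparam r n i → (Fin (M + 1) → ℝ)}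
    (hlin : IsLinearMap ℝ vc) (hvc0 : ∀ p, WGood V i p → vc p 0 = p.1)
    (hsurj : ∀ v, ∃ p, WGood V i p ∧ vc p = v) {m : Mat r n}
    {A : Matrix (Fin (M + 1)) (Fin (M + 1)) ℝ} (hA : A.IsSymm)
    (hq : ∀ p, WGood V i p → vc p ⬝ᵥ A *ᵥ vc p = tip m (toW i p * (toW i p)ᵀ))
    {T : Mat r n} (hT : T ∈ lowSub V) {s : Fin (r + 1) → ℝ}
    (hst : ∀ K ∈ lowSub V,
      tip m (K * Tᵀ + T * Kᵀ) = 2 * ∑ k, s k * (tdiag K k / tdiag T k)) :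
    A *ᵥ vc (colParam T i) = Pi.single 0 (s i / tdiag T i) := by
  have key : ∀ p, WGood V i p →
      vc p ⬝ᵥ A *ᵥ vc (colParam T i) = p.1 * (s i / tdiag T i) := by
    intro p hp
    have h1 := two_mul_dotProduct_mulVec hlin hA hq hp (colParam_good V hT i)
    have h2 := hst _ (fullW_mem_lowSub V hp)
    have h3 := fullW_mul_transpose i p T _ (toW_colParam V hT i)
    have h4 : T * (fullW i p)ᵀ = toW i (colParam T i) * (toW i p)ᵀ := by
      have := congrArg Matrix.transpose h3
      simpa [Matrix.transpose_mul] using this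
    rw [h3, h4, ← h1] at h2
    have h5 : ∑ k, s k * (tdiag (fullW i p) k / tdiag T k) = p.1 * (s i / tdiag T i) := by
      rw [Finset.sum_eq_single i]
      · rw [tdiag_fullW, if_pos rfl]
        ring
      · intro k _ hk
        rw [tdiag_fullW, if_neg hk]
        simp
      · simp
    rw [h5] at h2
    linarith
  ext j
  obtain ⟨p, hp, hpv⟩ := hsurj (Pi.single j 1)
  have h := key p hp
  rw [← hvc0 p hp, hpv, single_one_dotProduct] at h
  rw [h, Pi.single_apply, Pi.single_apply]
  simp only [eq_comm (a := j)]
  split_ifs <;> simp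

/-- Let `s ∈ 𝔛` with all `s_k > 0`, and let `ψ_s : 𝒬 → 𝒫` denote the
inverse of the mean map of the natural exponential family `F(R*_s)` generated by the Riesz
measure `R*_s` (Laplace transform `Δ_{-s}` on `𝒫`).  Then for every `m ∈ 𝒬`:
`ψ_s(m) = s_r φ_r^*(φ_r(m)⁻¹) + Σ_{i<r} s_i (φ_i^*(φ_i(m)⁻¹) - φ̌_i^*(φ̌_i(m)⁻¹))`. -/
theorem statement8 (r : ℕ) (n : Fin (r + 1) → ℕ+)
    (V : ∀ l k : Fin (r + 1), Submodule ℝ (Matrix (Fin (n l)) (Fin (n k)) ℝ))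
    (hV1 : CondV1 V) (hV2 : CondV2 V) (hV3 : CondV3 V)
    (rstar : Mat r n → Mat r n → Mat r n)
    (hrstar : ∀ T ∈ Hgrp V, ∀ ξ ∈ Zspace V, rstar T ξ ∈ Zspace V ∧
      ∀ x ∈ Zspace V, tip (rstar T ξ) x = tip ξ (rhoM T x))
    (Δf : (Fin (r + 1) → ℝ) → Mat r n → ℝ)
    (hΔ : ∀ s : Fin (r + 1) → ℝ, ∀ T ∈ Hgrp V, Δf s (rhoM T 1) = chi s T)
    (mdc : Fin (r + 1) → ℕ)
    (hmdc : ∀ i, mdc i = ∑ l ∈ Finset.univ.filter (fun l => i < l), Module.finrank ℝ (V l i))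
    (vc : ∀ i : Fin (r + 1), Wparam r n i → (Fin (mdc i + 1) → ℝ))
    (hvclin : ∀ i, IsLinearMap ℝ (vc i))
    (hvc0 : ∀ i p, WGood V i p → vc i p 0 = p.1)
    (hvcip : ∀ i p p', WGood V i p → WGood V i p' →
      ∑ j, vc i p j * vc i p' j
        = p.1 * p'.1 + ∑ l ∈ Finset.univ.filter (fun l => i < l), bip l (p.2 l) (p'.2 l))
    (hvcsurj : ∀ i (v : Fin (mdc i + 1) → ℝ), ∃ p, WGood V i p ∧ vc i p = v)
    (φ : ∀ i : Fin (r + 1), Mat r n → Matrix (Fin (mdc i + 1)) (Fin (mdc i + 1)) ℝ)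
    (hφ : ∀ i, ∀ ξ ∈ Zspace V, (φ i ξ).IsSymm ∧ ∀ p, WGood V i p →
      vc i p ⬝ᵥ (φ i ξ).mulVec (vc i p) = tip ξ (toW i p * (toW i p)ᵀ))
    (φc : ∀ i : Fin (r + 1), Mat r n → Matrix (Fin (mdc i)) (Fin (mdc i)) ℝ)
    (hφc : ∀ i, ∀ ξ ∈ Zspace V, (φc i ξ).IsSymm ∧ ∀ p, WGood V i p → p.1 = 0 →
      (fun j => vc i p j.succ) ⬝ᵥ (φc i ξ).mulVec (fun j => vc i p j.succ)
        = tip ξ (toW i p * (toW i p)ᵀ))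
    (φs : ∀ i : Fin (r + 1), Matrix (Fin (mdc i + 1)) (Fin (mdc i + 1)) ℝ → Mat r n)
    (hφs : ∀ i (X : Matrix (Fin (mdc i + 1)) (Fin (mdc i + 1)) ℝ), X.IsSymm →
      φs i X ∈ Zspace V ∧ ∀ ξ ∈ Zspace V, tip ξ (φs i X) = (φ i ξ * X).trace)
    (φcs : ∀ i : Fin (r + 1), Matrix (Fin (mdc i)) (Fin (mdc i)) ℝ → Mat r n)
    (hφcs : ∀ i (X : Matrix (Fin (mdc i)) (Fin (mdc i)) ℝ), X.IsSymm →
      φcs i X ∈ Zspace V ∧ ∀ ξ ∈ Zspace V, tip ξ (φcs i X) = (φc i ξ * X).trace)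
    (s : Fin (r + 1) → ℝ) (hs : s ∈ frakX V) (hspos : ∀ k, 0 < s k)
    (μ : Measure (Mat r n)) (hμsupp : μ (Zspace V)ᶜ = 0)
    (hμL : ∀ θ ∈ Pcone V, laplace μ θ = ENNReal.ofReal (Δf (-s) θ))
    (ψ : Mat r n → Mat r n)
    (hψ : ∀ m ∈ Qcone V, ψ m ∈ Pcone V ∧ meanMap μ (ψ m) = m) :
    ∀ m ∈ Qcone V,
      ψ m = s (Fin.last r) • φs (Fin.last r) ((φ (Fin.last r) m)⁻¹)
        + ∑ i ∈ Finset.univ.filter (fun i => i ≠ Fin.last r),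
            s i • (φs i ((φ i m)⁻¹) - φcs i ((φc i m)⁻¹)) := by
  intro m hm
  obtain ⟨hψP, hψm⟩ := hψ m hm
  obtain ⟨T, hT, hθ⟩ := exists_mem_Hgrp V hV2 hV3 hψP
  obtain ⟨hTl, hTd⟩ := (mem_Hgrp_iff V).1 hT
  have hst : ∀ K ∈ lowSub V,
      tip m (K * Tᵀ + T * Kᵀ) = 2 * ∑ k, s k * (tdiag K k / tdiag T k) := by
    intro K hK
    rw [hθ] at hψP hψm
    have := tip_mean_symm V hV2 hV3 hΔ hμsupp hμL hT hψP hK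
    rwa [hψm] at this
  have hpd : ∀ i, (φ i m).PosDef := fun i =>
    posDef_of_mem_Qcone hV2 hV3 (hvclin i) (hvcsurj i) hm (hφ i m hm.1).1 (hφ i m hm.1).2
  have hsub : ∀ i, ∀ ξ ∈ Zspace V, φc i ξ = (φ i ξ).submatrix Fin.succ Fin.succ := fun i ξ hξ =>
    eq_submatrix_succ (hvc0 i) (hvcsurj i) (hφ i ξ hξ).1 (hφ i ξ hξ).2 (hφc i ξ hξ).1
      (hφc i ξ hξ).2
  have hX : ∀ i, ((φ i m)⁻¹).IsSymm := fun i => by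
    rw [Matrix.IsSymm, Matrix.transpose_nonsing_inv, (hφ i m hm.1).1.eq]
  have hXc : ∀ i, ((φc i m)⁻¹).IsSymm := fun i => by
    rw [Matrix.IsSymm, Matrix.transpose_nonsing_inv, (hφc i m hm.1).1.eq]
  have hterm : ∀ i, ∀ ξ ∈ Zspace V,
      s i * ((φ i ξ * (φ i m)⁻¹).trace - (φc i ξ * (φc i m)⁻¹).trace)
        = tip ξ (toW i (colParam T i) * (toW i (colParam T i))ᵀ) := by
    intro i ξ hξ
    have hu := mulVec_vc_colParam V (hvclin i) (hvc0 i) (hvcsurj i) (hφ i m hm.1).1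
      (hφ i m hm.1).2 hTl hst
    have hs1 : s i / tdiag T i * vc i (colParam T i) 0 = s i := by
      rw [hvc0 i _ (colParam_good V hTl i)]
      exact div_mul_cancel₀ _ (hTd i).ne'
    rw [hsub i ξ hξ, hsub i m hm.1,
      trace_mul_inv_sub_trace_mul_inv (hpd i) (φ i ξ) hu hs1 (hspos i).ne',
      mul_div_cancel₀ _ (hspos i).ne', (hφ i ξ hξ).2 _ (colParam_good V hTl i)]
  have hlast : ∀ Y : Matrix (Fin (mdc (Fin.last r))) (Fin (mdc (Fin.last r))) ℝ,
      Y.trace = 0 := by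
    have h0 : mdc (Fin.last r) = 0 := by
      rw [hmdc, Finset.sum_eq_zero]
      intro l hl
      exact absurd (Finset.mem_filter.1 hl).2 (not_lt.2 (Fin.le_last l))
    rw [h0]
    intro Y
    exact Matrix.trace_fin_zero Y
  refine eq_of_forall_tip V hψP.1 ?_ fun ξ hξ => ?_
  · refine Submodule.add_mem _ (Submodule.smul_mem _ _ (hφs _ _ (hX _)).1)
      (Submodule.sum_mem _ fun i _ => Submodule.smul_mem _ _
        (Submodule.sub_mem _ (hφs _ _ (hX _)).1 (hφcs _ _ (hXc _)).1))
  · rw [hθ, ← sum_toW_colParam V hTl, tip_sum_right, tip_add_right, tip_sum_right,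
      tip_smul_right, (hφs _ _ (hX _)).2 ξ hξ, Finset.filter_ne',
      ← Finset.add_sum_erase _ _ (Finset.mem_univ (Fin.last r)), ← hterm _ ξ hξ, hlast, sub_zero]
    congr 1
    refine Finset.sum_congr rfl fun i _ => ?_
    rw [← hterm i ξ hξ, tip_smul_right, tip_sub_right, (hφs _ _ (hX _)).2 ξ hξ,
      (hφcs _ _ (hXc _)).2 ξ hξ]

end Wishart
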